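/- Let I = (S,A,α,c,c_h,P̲,P̄,h) be an IMDP and let V̄*_k be defined by V̄*_h := c_h and the backward recursion V̄*_k(s) := min_{π_k ∈ P^{|A|}} max_{(p^a)_{a∈A}, p^a ∈ P_s^a} [∑_{a∈A} π_k^a·c(s,a) + Φ(∑_{a∈A} π_k^a·p^a, V̄*_{k+1})]. Then for every k ∈ {0,…,h-1} and s ∈ S the same values are obtained by minimizing over single actions only: V̄*_k(s) = min_{a∈A} max_{p ∈ P_s^a} [c(s,a) + Φ(p, V̄*_{k+1})]. -/

import Mathlib

open Finset

/-- The probability simplex over a finite type `T`. -/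
def Simplex (T : Type) [Fintype T] : Set (T → ℝ) :=
  {p | (∀ t, 0 ≤ p t ∧ p t ≤ 1) ∧ ∑ t, p t = 1}

/-- `Φ(p,V) = -∑_q p_q log₂ p_q + ∑_q p_q V_q` (with `0·log₂ 0 = 0`,
which holds automatically since `Real.logb 2 0 = 0`). -/
noncomputable def Phi {S : Type} [Fintype S] (p V : S → ℝ) : ℝ :=
  (-∑ q, p q * Real.logb 2 (p q)) + ∑ q, p q * V q

/-- The set `P_s^a` of feasible transition distributions for state `s` and action
`a`, given interval bounds `P̲ = Plo` and `P̄ = Pup`. -/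
def Feas {S A : Type} [Fintype S] (Plo Pup : S → A → S → ℝ) (s : S) (a : A) :
    Set (S → ℝ) :=
  {p | p ∈ Simplex S ∧ ∀ q, Plo s a q ≤ p q ∧ p q ≤ Pup s a q}

theorem simplex_eq_stdSimplex (T : Type) [Fintype T] : Simplex T = stdSimplex ℝ T := by
  ext p
  refine ⟨fun hp => ⟨fun t => (hp.1 t).1, hp.2⟩, fun hp => ⟨fun t => ⟨hp.1 t, ?_⟩, hp.2⟩⟩
  rw [← hp.2]
  exact Finset.single_le_sum (fun i _ => hp.1 i) (Finset.mem_univ t)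

theorem Phi_eq_negMulLog {S : Type} [Fintype S] (p V : S → ℝ) :
    Phi p V = ∑ q, ((Real.log 2)⁻¹ * Real.negMulLog (p q) + p q * V q) := by
  rw [Phi, Finset.sum_add_distrib, ← Finset.sum_neg_distrib]
  congr 1
  refine Finset.sum_congr rfl fun q _ => ?_
  simp only [Real.negMulLog, Real.logb]
  ring

theorem continuous_Phi {S : Type} [Fintype S] (V : S → ℝ) :
    Continuous fun p : S → ℝ => Phi p V := by
  simp only [Phi_eq_negMulLog]
  fun_prop

/-- Jensen's inequality for the concave function `Phi · V`. -/
theorem sum_mul_Phi_le {S A : Type} [Fintype S] [Fintype A] {π : A → ℝ} (hπ : π ∈ Simplex A)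
    {p : A → S → ℝ} (hp : ∀ a, p a ∈ Simplex S) (V : S → ℝ) :
    ∑ a, π a * Phi (p a) V ≤ Phi (fun q => ∑ a, π a * p a q) V := by
  simp only [Phi_eq_negMulLog, Finset.mul_sum]
  rw [Finset.sum_comm]
  refine Finset.sum_le_sum fun q _ => ?_
  have jensen := Real.concaveOn_negMulLog.le_map_sum (t := Finset.univ) (w := π)
    (p := fun a => p a q) (fun a _ => (hπ.1 a).1) hπ.2 (fun a _ => ((hp a).1 q).1)
  simp only [smul_eq_mul] at jensen
  have hlog : 0 ≤ (Real.log 2)⁻¹ := inv_nonneg.2 (Real.log_nonneg one_le_two)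
  calc ∑ a, π a * ((Real.log 2)⁻¹ * Real.negMulLog (p a q) + p a q * V q)
      = (Real.log 2)⁻¹ * ∑ a, π a * Real.negMulLog (p a q) + (∑ a, π a * p a q) * V q := by
        rw [Finset.mul_sum, Finset.sum_mul, ← Finset.sum_add_distrib]
        exact Finset.sum_congr rfl fun a _ => by ring
    _ ≤ _ := by gcongr

theorem sum_mul_mem_Simplex {S A : Type} [Fintype S] [Fintype A] {π : A → ℝ}
    (hπ : π ∈ Simplex A) {p : A → S → ℝ} (hp : ∀ a, p a ∈ Simplex S) :
    (fun q => ∑ a, π a * p a q) ∈ Simplex S := by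
  rw [simplex_eq_stdSimplex]
  refine ⟨fun q => Finset.sum_nonneg fun a _ => mul_nonneg (hπ.1 a).1 ((hp a).1 q).1, ?_⟩
  rw [Finset.sum_comm]
  simp only [← Finset.mul_sum, (hp _).2, mul_one, hπ.2]

theorem isCompact_Feas {S A : Type} [Fintype S] (Plo Pup : S → A → S → ℝ) (s : S) (a : A) :
    IsCompact (Feas Plo Pup s a) := by
  have hEq : Feas Plo Pup s a = stdSimplex ℝ S ∩ Set.Icc (Plo s a) (Pup s a) := by
    ext p
    simp only [Feas, simplex_eq_stdSimplex, Set.mem_ofPred_eq, Set.mem_inter_iff, Set.mem_Icc,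
      Pi.le_def, forall_and]
  rw [hEq]
  exact (isCompact_stdSimplex ℝ S).inter_right isClosed_Icc

theorem bddAbove_mixture_values {S A : Type} [Fintype S] [Fintype A]
    (Plo Pup : S → A → S → ℝ) (s : S) {π : A → ℝ} (hπ : π ∈ Simplex A) (r : ℝ) (V : S → ℝ) :
    BddAbove {y | ∃ pc : A → S → ℝ, (∀ a, pc a ∈ Feas Plo Pup s a) ∧
      y = r + Phi (fun q => ∑ a, π a * pc a q) V} := by
  obtain ⟨M, hM⟩ := (isCompact_stdSimplex ℝ S).bddAbove_image (continuous_Phi V).continuousOn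
  refine ⟨r + M, ?_⟩
  rintro _ ⟨pc, hpc, rfl⟩
  have hmem := sum_mul_mem_Simplex hπ fun a => (hpc a).1
  rw [simplex_eq_stdSimplex] at hmem
  exact add_le_add_right (hM (Set.mem_image_of_mem _ hmem)) r

theorem exists_Feas_sSup_eq {S A : Type} [Fintype S] {Plo Pup : S → A → S → ℝ} {s : S} {a : A}
    (hne : (Feas Plo Pup s a).Nonempty) (r : ℝ) (V : S → ℝ) :
    ∃ p ∈ Feas Plo Pup s a, sSup {y | ∃ p ∈ Feas Plo Pup s a, y = r + Phi p V} = r + Phi p V := by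
  obtain ⟨p, hp, hmax⟩ :=
    (isCompact_Feas Plo Pup s a).exists_isMaxOn hne (continuous_Phi V).continuousOn
  refine ⟨p, hp, IsGreatest.csSup_eq ⟨⟨p, hp, rfl⟩, ?_⟩⟩
  rintro _ ⟨p', hp', rfl⟩
  exact add_le_add_right (hmax hp') r

/-- in the value-iteration recursion for an IMDP, the minimization over
randomized action distributions `π_k ∈ P^{|A|}` can be replaced by minimization over
single actions:
`V̄*_k(s) = min_{a∈A} max_{p ∈ P_s^a} [c(s,a) + Φ(p, V̄*_{k+1})]`. -/
theorem value_iteration_deterministic_reduction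
    {S A : Type} [Fintype S] [Fintype A] [Nonempty S] [Nonempty A]
    (h : ℕ) (α : S → ℝ) (c : S → A → ℝ) (ch : S → ℝ)
    (Plo Pup : S → A → S → ℝ)
    (hα : α ∈ Simplex S)
    (hbounds : ∀ s a q, 0 ≤ Plo s a q ∧ Plo s a q ≤ Pup s a q ∧ Pup s a q ≤ 1)
    (hsums : ∀ s a, ∑ q, Plo s a q ≤ 1 ∧ 1 ≤ ∑ q, Pup s a q)
    (hfeas : ∀ s a, (Feas Plo Pup s a).Nonempty)
    -- the value-iteration recursion
    (V : ℕ → S → ℝ)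
    (hVh : ∀ s, V h s = ch s)
    (hV : ∀ k, k < h → ∀ s,
      V k s = sInf {x | ∃ πk ∈ Simplex A, x =
        sSup {y | ∃ pc : A → S → ℝ, (∀ a, pc a ∈ Feas Plo Pup s a) ∧
          y = (∑ a, πk a * c s a) +
            Phi (fun q => ∑ a, πk a * pc a q) (V (k + 1))}}) :
    ∀ k, k < h → ∀ s,
      V k s = ⨅ a : A, sSup {y | ∃ p ∈ Feas Plo Pup s a,
        y = c s a + Phi p (V (k + 1))} := by
  intro k hk s
  rw [hV k hk s]
  choose p hp hsup using fun a => exists_Feas_sSup_eq (hfeas s a) (c s a) (V (k + 1))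
  have lower : ∀ x ∈ {x | ∃ πk ∈ Simplex A, x =
        sSup {y | ∃ pc : A → S → ℝ, (∀ a, pc a ∈ Feas Plo Pup s a) ∧
          y = (∑ a, πk a * c s a) +
            Phi (fun q => ∑ a, πk a * pc a q) (V (k + 1))}},
      (⨅ a : A, sSup {y | ∃ p ∈ Feas Plo Pup s a, y = c s a + Phi p (V (k + 1))}) ≤ x := by
    rintro _ ⟨π, hπ, rfl⟩
    refine le_trans ?_ (le_csSup (bddAbove_mixture_values Plo Pup s hπ _ _) ⟨p, hp, rfl⟩)
    refine le_trans ?_ (add_le_add_right (sum_mul_Phi_le hπ (fun a => (hp a).1) _) _)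
    simp only [hsup]
    rw [← Finset.sum_add_distrib, ← one_mul (iInf _), ← hπ.2, Finset.sum_mul]
    refine Finset.sum_le_sum fun a _ => ?_
    rw [← mul_add]
    exact mul_le_mul_of_nonneg_left (ciInf_le (Set.finite_range _).bddBelow a) (hπ.1 a).1
  classical
  have dirac_mem (a : A) : Pi.single a (1 : ℝ) ∈ Simplex A := by
    rw [simplex_eq_stdSimplex]
    exact single_mem_stdSimplex ℝ a
  refine le_antisymm (le_ciInf fun a => csInf_le ⟨_, lower⟩ ⟨Pi.single a 1, dirac_mem a, ?_⟩)
    (le_csInf ⟨_, Pi.single (Classical.arbitrary A) 1, dirac_mem _, rfl⟩ lower)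
  congr 1
  ext y
  simp only [Pi.single_apply, ite_mul, one_mul, zero_mul, Finset.sum_ite_eq', Finset.mem_univ,
    if_true, Set.mem_ofPred_eq]
  constructor
  · rintro ⟨p', hp', rfl⟩
    refine ⟨Function.update p a p', fun b => ?_, by simp⟩
    obtain rfl | hb := eq_or_ne b a
    · simpa using hp'
    · simpa [hb] using hp b
  · rintro ⟨pc, hpc, rfl⟩
    exact ⟨pc a, hpc a, rfl⟩
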